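/- Let 0 ≤ ω ≤ 1 and 0 < x ≤ π/2. Then (1−ω)²·cos(x) ≥ cos_*(x + 2ω·cot(x)), where cot(x) = cos(x)/sin(x) and cos_*(t) := cos(t) if 0 ≤ t ≤ π/2 and cos_*(t) := 0 otherwise. -/

import Mathlib

open Real

/-- The truncated cosine: `cos_* t = cos t` for `0 ≤ t ≤ π/2`, and `0` otherwise. -/
noncomputable def cosStar (t : ℝ) : ℝ :=
  if 0 ≤ t ∧ t ≤ Real.pi / 2 then Real.cos t else 0

/-- On `[0, π)`, the bound `t cos² (t/2) ≤ sin t`, with `cos²` written through `sin²`. -/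
theorem mul_one_sub_sin_half_sq_le_sin {t : ℝ} (ht0 : 0 ≤ t) (ht1 : t < Real.pi) :
    t * (1 - Real.sin (t / 2) ^ 2) ≤ Real.sin t := by
  have hcos : 0 < Real.cos (t / 2) := Real.cos_pos_of_mem_Ioo ⟨by linarith, by linarith⟩
  have htan : t / 2 ≤ Real.tan (t / 2) := Real.le_tan (by linarith) (by linarith)
  rw [Real.tan_eq_sin_div_cos, le_div_iff₀ hcos] at htan
  have hsin : Real.sin t = 2 * Real.sin (t / 2) * Real.cos (t / 2) := by
    rw [← Real.sin_two_mul]; ring_nf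
  rw [hsin, ← Real.cos_sq']
  nlinarith [mul_le_mul_of_nonneg_right htan hcos.le]

/-- For `0 ≤ ω ≤ 1` and `0 < x ≤ π/2`,
`(1-ω)² cos x ≥ cos_* (x + 2ω·cot x)`. -/
theorem truncated_cosine_lemma (ω x : ℝ) (hω0 : 0 ≤ ω) (hω1 : ω ≤ 1)
    (hx0 : 0 < x) (hx1 : x ≤ Real.pi / 2) :
    (1 - ω) ^ 2 * Real.cos x ≥ cosStar (x + 2 * ω * (Real.cos x / Real.sin x)) := by
  have hcos : 0 ≤ Real.cos x := Real.cos_nonneg_of_mem_Icc ⟨by linarith, hx1⟩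
  have hsin : 0 < Real.sin x := Real.sin_pos_of_pos_of_lt_pi hx0 (by linarith)
  unfold cosStar
  split_ifs with h
  · obtain ⟨t, ht⟩ : ∃ t, t = 2 * ω * (Real.cos x / Real.sin x) := ⟨_, rfl⟩
    rw [← ht] at h ⊢
    have ht0 : 0 ≤ t := by rw [ht]; positivity
    have hts : t * Real.sin x = 2 * ω * Real.cos x := by rw [ht]; field_simp
    have hbound := mul_le_mul_of_nonneg_left
      (mul_one_sub_sin_half_sq_le_sin ht0 (by linarith [h.2])) hsin.le
    have hcost : Real.cos t = 1 - 2 * Real.sin (t / 2) ^ 2 := by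
      rw [Real.sin_sq_eq_half_sub]; ring_nf
    have hq : 0 ≤ ω ^ 2 - 2 * ω * Real.sin (t / 2) ^ 2 + 2 * Real.sin (t / 2) ^ 2 := by
      nlinarith [sq_nonneg (Real.sin (t / 2)), sq_nonneg ω]
    rw [Real.cos_add, hcost]
    linear_combination hbound + mul_nonneg hcos hq - (1 - Real.sin (t / 2) ^ 2) * hts
  · positivity
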